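/- arXiv:1208.3759 — 4 statements merged into one kernel-verified Lean document; each statement's English description precedes it below -/
import Mathlib

section
/- Let T be the attractor of the iterated function system {x ↦ A^{−1}(x + d) : d ∈ 𝒟} for an expanding 2×2 integer matrix A with A² = −3I and digit set 𝒟 = {0, v, kAv} where |k| > 1 and {v, Av} is linearly independent. Then T ∩ (T + kAv) = ∅ and (T + v) ∩ (T + kAv) = ∅; consequently T is disconnected. -/
open Matrix

/-- `A` has integer entries. -/
def IsIntMat (A : Matrix (Fin 2) (Fin 2) ℝ) : Prop :=
  ∀ i j, ∃ m : ℤ, A i j = (m : ℝ)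

/-- The self-affine set `T(A, D) = {∑_{i≥1} A^{-i} d_i : d_i ∈ D}`. -/
noncomputable def selfAffine (A : Matrix (Fin 2) (Fin 2) ℝ) (D : Set (Fin 2 → ℝ)) :
    Set (Fin 2 → ℝ) :=
  { x | ∃ d : ℕ → (Fin 2 → ℝ), (∀ n, d n ∈ D) ∧
      HasSum (fun n => (A⁻¹ ^ (n + 1)) *ᵥ d n) x }

section SelfAffineDisconnected

variable {A : Matrix (Fin 2) (Fin 2) ℝ}

lemma inv_eq_of_mul_self_add_three (h : A * A + (3 : ℝ) • (1 : Matrix (Fin 2) (Fin 2) ℝ) = 0) :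
    A⁻¹ = (-1 / 3 : ℝ) • A := by
  apply Matrix.inv_eq_right_inv
  rw [Matrix.mul_smul, eq_neg_of_add_eq_zero_left h, ← neg_smul, smul_smul]
  norm_num

lemma inv_pow_two_mul_add_two
    (h : A * A + (3 : ℝ) • (1 : Matrix (Fin 2) (Fin 2) ℝ) = 0) (j : ℕ) :
    A⁻¹ ^ (2 * j + 2) = ((-1 / 3 : ℝ) ^ (j + 1)) • (1 : Matrix (Fin 2) (Fin 2) ℝ) := by
  have hsq : A⁻¹ ^ 2 = (-1 / 3 : ℝ) • (1 : Matrix (Fin 2) (Fin 2) ℝ) := by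
    rw [inv_eq_of_mul_self_add_three h, smul_pow, pow_two A, eq_neg_of_add_eq_zero_left h,
      ← neg_smul, smul_smul]
    norm_num
  rw [show 2 * j + 2 = 2 * (j + 1) by ring, pow_mul, hsq, smul_pow, one_pow]

lemma inv_pow_two_mul_add_one
    (h : A * A + (3 : ℝ) • (1 : Matrix (Fin 2) (Fin 2) ℝ) = 0) (j : ℕ) :
    A⁻¹ ^ (2 * j + 1) = ((-1 / 3 : ℝ) ^ (j + 1)) • A := by
  have hinv := inv_eq_of_mul_self_add_three h
  cases j with
  | zero => simpa using hinv
  | succ i =>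
    rw [show 2 * (i + 1) + 1 = (2 * i + 2) + 1 by ring, pow_succ, inv_pow_two_mul_add_two h i,
      hinv, Matrix.smul_mul, Matrix.one_mul, smul_smul, ← pow_succ]

lemma det_isUnit_of_mul_self_add_three
    (h : A * A + (3 : ℝ) • (1 : Matrix (Fin 2) (Fin 2) ℝ) = 0) : IsUnit A.det := by
  apply Matrix.isUnit_det_of_right_inverse (B := (-1 / 3 : ℝ) • A)
  rw [Matrix.mul_smul, eq_neg_of_add_eq_zero_left h, ← neg_smul, smul_smul]
  norm_num

/-- The shift on digit sequences: `A x - d` lies in the self-affine set for the leading digit `d`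
of `x`. -/
lemma exists_digit_of_mem_selfAffine (hA : IsUnit A.det) {D : Set (Fin 2 → ℝ)} {x : Fin 2 → ℝ}
    (hx : x ∈ selfAffine A D) : ∃ d ∈ D, ∃ t ∈ selfAffine A D, A *ᵥ x = t + d := by
  obtain ⟨d, hd, hs⟩ := hx
  refine ⟨d 0, hd 0, A *ᵥ x - d 0, ⟨fun n => d (n + 1), fun n => hd _, ?_⟩, by simp⟩
  have hmap := hs.mapL (LinearMap.toContinuousLinearMap (Matrix.mulVecLin A))
  have hshift := (hasSum_nat_add_iff' 1).mpr hmap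
  have hterm : ∀ (n : ℕ) (w : Fin 2 → ℝ), A *ᵥ (A⁻¹ ^ (n + 1) *ᵥ w) = A⁻¹ ^ n *ᵥ w := by
    intro n w
    rw [Matrix.mulVec_mulVec, pow_succ', ← Matrix.mul_assoc, Matrix.mul_nonsing_inv _ hA,
      Matrix.one_mul]
  simpa only [LinearMap.coe_toContinuousLinearMap', Matrix.mulVecLin_apply, hterm,
    Finset.sum_range_one, pow_zero, Matrix.one_mulVec] using hshift

/-- If `φ` and `φ ∘ A` take values in `{0, k}` and `{0, 1}` on the digits, then `φ` maps the
self-affine set into an interval of length `(1 + |k|) / 2`. -/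
lemma abs_apply_add_le_of_mem_selfAffine
    (h : A * A + (3 : ℝ) • (1 : Matrix (Fin 2) (Fin 2) ℝ) = 0) {D : Set (Fin 2 → ℝ)} {k : ℝ}
    (φ : (Fin 2 → ℝ) →ₗ[ℝ] ℝ) (hφ : ∀ d ∈ D, φ d = 0 ∨ φ d = k)
    (hφA : ∀ d ∈ D, φ (A *ᵥ d) = 0 ∨ φ (A *ᵥ d) = 1)
    {x : Fin 2 → ℝ} (hx : x ∈ selfAffine A D) :
    |φ x + (1 + k) / 8| ≤ (1 + |k|) / 4 := by
  obtain ⟨d, hd, hs⟩ := hx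
  have hlim := (hs.mapL (LinearMap.toContinuousLinearMap φ)).tendsto_sum_nat.comp
    (Filter.tendsto_id.const_mul_atTop' (show 0 < 2 by norm_num))
  have hdigit : ∀ j, |φ (A *ᵥ d (2 * j)) + φ (d (2 * j + 1)) - (1 + k) / 2| ≤ (1 + |k|) / 2 := by
    intro j
    have hk₁ := le_abs_self k
    have hk₂ := neg_abs_le k
    rw [abs_le]
    rcases hφA _ (hd (2 * j)) with h₁ | h₁ <;> rcases hφ _ (hd (2 * j + 1)) with h₂ | h₂ <;>
      rw [h₁, h₂] <;> constructor <;> linarith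
  have hpartial : ∀ N : ℕ,
      |∑ n ∈ Finset.range (2 * N), φ (A⁻¹ ^ (n + 1) *ᵥ d n)
        + (1 + k) / 8 * (1 - (-1 / 3) ^ N)| ≤ (1 + |k|) / 4 * (1 - (1 / 3) ^ N) := by
    intro N
    induction N with
    | zero => simp
    | succ N ih =>
      have hstep : ∑ n ∈ Finset.range (2 * (N + 1)), φ (A⁻¹ ^ (n + 1) *ᵥ d n)
          + (1 + k) / 8 * (1 - (-1 / 3) ^ (N + 1))
          = (∑ n ∈ Finset.range (2 * N), φ (A⁻¹ ^ (n + 1) *ᵥ d n)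
              + (1 + k) / 8 * (1 - (-1 / 3) ^ N))
            + (-1 / 3) ^ (N + 1)
              * (φ (A *ᵥ d (2 * N)) + φ (d (2 * N + 1)) - (1 + k) / 2) := by
        rw [show 2 * (N + 1) = 2 * N + 1 + 1 by ring, Finset.sum_range_succ,
          Finset.sum_range_succ, inv_pow_two_mul_add_one h, inv_pow_two_mul_add_two h]
        simp only [Matrix.smul_mulVec, Matrix.one_mulVec, map_smul, smul_eq_mul]
        ring
      have habs : |(-1 / 3 : ℝ) ^ (N + 1)| = (1 / 3) ^ (N + 1) := by
        rw [abs_pow]; norm_num [abs_of_neg]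
      rw [hstep]
      calc _ ≤ _ := abs_add_le _ _
        _ ≤ (1 + |k|) / 4 * (1 - (1 / 3) ^ N) + (1 / 3) ^ (N + 1) * ((1 + |k|) / 2) := by
          rw [abs_mul, habs]
          gcongr
          exact hdigit N
        _ = _ := by ring
  have h₁ : Filter.Tendsto (fun N : ℕ => (-1 / 3 : ℝ) ^ N) Filter.atTop (nhds 0) :=
    tendsto_pow_atTop_nhds_zero_of_abs_lt_one (by norm_num [abs_lt])
  have h₂ : Filter.Tendsto (fun N : ℕ => (1 / 3 : ℝ) ^ N) Filter.atTop (nhds 0) :=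
    tendsto_pow_atTop_nhds_zero_of_abs_lt_one (by norm_num [abs_lt])
  have hl := (hlim.add ((h₁.const_sub 1).const_mul ((1 + k) / 8))).abs
  have hr := (h₂.const_sub 1).const_mul ((1 + |k|) / 4)
  simpa using le_of_tendsto_of_tendsto' hl hr hpartial

lemma zero_mem_selfAffine {D : Set (Fin 2 → ℝ)} (h0 : (0 : Fin 2 → ℝ) ∈ D) :
    (0 : Fin 2 → ℝ) ∈ selfAffine A D :=
  ⟨fun _ => 0, fun _ => h0, by simp⟩

lemma inv_mulVec_mem_selfAffine {D : Set (Fin 2 → ℝ)} (h0 : (0 : Fin 2 → ℝ) ∈ D)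
    {d : Fin 2 → ℝ} (hd : d ∈ D) : A⁻¹ *ᵥ d ∈ selfAffine A D := by
  refine ⟨fun n => if n = 0 then d else 0, fun n => ?_, ?_⟩
  · dsimp only
    split_ifs
    exacts [hd, h0]
  · convert hasSum_single (f := fun n : ℕ => A⁻¹ ^ (n + 1) *ᵥ (if n = 0 then d else 0)) 0 ?_
      using 1
    · simp
    · intro n hn
      simp [hn]

/-- The coordinate functional along `w` of the basis `(v, w)` of the plane. -/
lemma exists_linearMap_of_linearIndependent_pair {v w : Fin 2 → ℝ}
    (hv : LinearIndependent ℝ ![v, w]) :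
    ∃ φ : (Fin 2 → ℝ) →ₗ[ℝ] ℝ, φ v = 0 ∧ φ w = 1 := by
  let b := basisOfLinearIndependentOfCardEqFinrank hv (by simp)
  have hb : ∀ i, b i = ![v, w] i := fun i => by simp [b]
  refine ⟨b.coord 1, ?_, ?_⟩
  · simpa [hb] using b.repr_self_apply 0 1
  · simpa [hb] using b.repr_self_apply 1 1

end SelfAffineDisconnected

theorem stmt6 (A : Matrix (Fin 2) (Fin 2) ℝ) (hint : IsIntMat A)
    (h : A * A + (3 : ℝ) • (1 : Matrix (Fin 2) (Fin 2) ℝ) = 0)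
    (k : ℤ) (hk : 1 < |k|)
    (v : Fin 2 → ℝ) (hv : LinearIndependent ℝ ![v, A *ᵥ v])
    (D : Set (Fin 2 → ℝ)) (hD : D = {0, v, (k : ℝ) • (A *ᵥ v)})
    (T : Set (Fin 2 → ℝ)) (hT : T = selfAffine A D) :
    T ∩ ((fun x => x + (k : ℝ) • (A *ᵥ v)) '' T) = ∅ ∧
    ((fun x => x + v) '' T) ∩ ((fun x => x + (k : ℝ) • (A *ᵥ v)) '' T) = ∅ ∧
    ¬ IsConnected T := by
  subst hD hT
  generalize hw : A *ᵥ v = w at hv ⊢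
  obtain ⟨φ, hφv, hφw⟩ := exists_linearMap_of_linearIndependent_pair hv
  have hA := det_isUnit_of_mul_self_add_three h
  have hAw : A *ᵥ w = (-3 : ℝ) • v := by
    rw [← hw, Matrix.mulVec_mulVec, eq_neg_of_add_eq_zero_left h, ← neg_smul, Matrix.smul_mulVec,
      Matrix.one_mulVec]
  have hk' : (1 : ℝ) < |(k : ℝ)| := by exact_mod_cast hk
  set D : Set (Fin 2 → ℝ) := {0, v, (k : ℝ) • w} with hD
  have hφ : ∀ d ∈ D, φ d = 0 ∨ φ d = k := by
    rintro d (hd | hd | hd) <;> rw [hd]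
    · exact .inl (map_zero φ)
    · exact .inl hφv
    · right
      rw [map_smul, hφw, smul_eq_mul, mul_one]
  have hφA : ∀ d ∈ D, φ (A *ᵥ d) = 0 ∨ φ (A *ᵥ d) = 1 := by
    rintro d (hd | hd | hd) <;> rw [hd]
    · simp
    · exact .inr (by rw [hw, hφw])
    · left
      rw [Matrix.mulVec_smul, hAw, map_smul, map_smul, hφv, smul_zero, smul_zero]
  have hbound : ∀ t ∈ selfAffine A D, |φ t + (1 + k) / 8| ≤ (1 + |(k : ℝ)|) / 4 :=
    fun t ht => abs_apply_add_le_of_mem_selfAffine h φ hφ hφA ht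
  have hsep : ∀ t ∈ selfAffine A D, ∀ s ∈ selfAffine A D, φ t ≠ φ s + k := by
    intro t ht s hs heq
    have hts := abs_sub (φ t + (1 + k) / 8) (φ s + (1 + k) / 8)
    rw [show φ t + (1 + k) / 8 - (φ s + (1 + k) / 8) = k by rw [heq]; ring] at hts
    linarith [hbound t ht, hbound s hs]
  refine ⟨?_, ?_, fun hconn => ?_⟩
  · rw [Set.eq_empty_iff_forall_notMem]
    rintro t ⟨ht, s, hs, rfl⟩
    exact hsep _ ht s hs (by simp [hφw])
  · rw [Set.eq_empty_iff_forall_notMem]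
    rintro _ ⟨⟨t, ht, rfl⟩, s, hs, heq⟩
    refine hsep t ht s hs ?_
    simpa [hφv, hφw] using (congrArg φ heq).symm
  · have h0 : (0 : Fin 2 → ℝ) ∈ D := by simp [hD]
    have hcont : Continuous fun x => φ (A *ᵥ x) :=
      (φ ∘ₗ Matrix.mulVecLin A).continuous_of_finiteDimensional
    have himage := (hconn.isPreconnected.image _ hcont.continuousOn).ordConnected
    have hzero : (0 : ℝ) ∈ (fun x => φ (A *ᵥ x)) '' selfAffine A D :=
      ⟨0, zero_mem_selfAffine h0, by simp⟩
    have hkmem : (k : ℝ) ∈ (fun x => φ (A *ᵥ x)) '' selfAffine A D :=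
      ⟨_, inv_mulVec_mem_selfAffine h0 (d := (k : ℝ) • w) (by simp [hD]), by
        simp only [Matrix.mulVec_mulVec, Matrix.mul_nonsing_inv _ hA, Matrix.one_mulVec]
        simp [hφw]⟩
    have hb0 := abs_le.mp (hbound 0 (zero_mem_selfAffine h0))
    rw [map_zero] at hb0
    -- The midpoint of the gap between the two clusters of values of `φ ∘ A`.
    have hmid : (k : ℝ) / 2 - (1 + k) / 8 ∈ (fun x => φ (A *ᵥ x)) '' selfAffine A D := by
      apply himage.uIcc_subset hzero hkmem
      rw [Set.mem_uIcc]
      rcases abs_cases (k : ℝ) with ⟨hk₁, _⟩ | ⟨hk₁, _⟩ <;> rw [hk₁] at hb0 hk'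
      · left; constructor <;> linarith
      · right; constructor <;> linarith
    obtain ⟨x, hx, hxm⟩ := hmid
    obtain ⟨d, hd, t, ht, hxt⟩ := exists_digit_of_mem_selfAffine hA hx
    have hbt := abs_le.mp (hbound t ht)
    simp only [hxt, map_add] at hxm
    rcases abs_cases (k : ℝ) with ⟨hk₁, _⟩ | ⟨hk₁, _⟩ <;> rw [hk₁] at hbt hk' <;>
      rcases hφ d hd with hφd | hφd <;> rw [hφd] at hxm <;> linarith
end

section
/- Let A be a 2×2 matrix with A² + A + 3I = 0 and v a vector with {v, Av} linearly independent. Then v = ∑_{i=0}^{∞} A^{−3i}(A^{−2}(−v) + A^{−3}(v − Av) + A^{−4}(Av)) and Av = ∑_{i=0}^{∞} A^{−3i}(A^{−1}(−v) + A^{−2}(v − Av) + A^{−3}(Av)). Consequently, for 𝒟 = {0, v, Av}, both v and Av belong to T(A,𝒟) − T(A,𝒟), and T(A,𝒟) is connected. -/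
open Matrix
open scoped Pointwise

/-- A root `B` of `3X² + X + 1` has geometrically decaying powers. -/
theorem exists_norm_pow_mulVec_le {B : Matrix (Fin 2) (Fin 2) ℝ}
    (hB : (3 : ℝ) • (B * B) + B + 1 = 0) :
    ∃ C : ℝ, 0 ≤ C ∧ ∀ (n : ℕ) (x : Fin 2 → ℝ), ‖(B ^ n) *ᵥ x‖ ≤ C * (3 / 5) ^ n * ‖x‖ := by
  have hBB : B * B = (-(1 / 3) : ℝ) • B + (-(1 / 3) : ℝ) • (1 : Matrix (Fin 2) (Fin 2) ℝ) := by
    linear_combination (norm := module) (1 / 3 : ℝ) • hB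
  have hpow : ∀ n : ℕ, ∃ a b : ℝ, B ^ n = a • B + b • (1 : Matrix (Fin 2) (Fin 2) ℝ) ∧
      a ^ 2 - a * b + 3 * b ^ 2 = 3 * (1 / 3) ^ n := by
    intro n
    induction n with
    | zero => exact ⟨0, 1, by simp, by norm_num⟩
    | succ n ih =>
      obtain ⟨a, b, hab, hq⟩ := ih
      refine ⟨b - a / 3, -(a / 3), ?_, ?_⟩
      · rw [pow_succ, hab, add_mul, smul_mul_assoc, smul_mul_assoc, one_mul, hBB]
        module
      · rw [pow_succ]
        linear_combination (1 / 3) * hq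
  have hr : ∀ n : ℕ, ((1 / 3 : ℝ)) ^ n ≤ ((3 / 5) ^ n) ^ 2 := by
    intro n
    rw [← pow_mul, mul_comm, pow_mul]
    gcongr
    norm_num
  set L := (Matrix.mulVecLin B).toContinuousLinearMap
  refine ⟨2 * ‖L‖ + 2, by positivity, fun n x => ?_⟩
  obtain ⟨a, b, hab, hq⟩ := hpow n
  have hrn : (0 : ℝ) ≤ (3 / 5) ^ n := by positivity
  have ha : |a| ≤ 2 * (3 / 5) ^ n :=
    abs_le_of_sq_le_sq (by nlinarith [hr n, sq_nonneg (a - 6 * b)]) (by positivity)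
  have hb : |b| ≤ 2 * (3 / 5) ^ n :=
    abs_le_of_sq_le_sq (by nlinarith [hr n, sq_nonneg (2 * a - b)]) (by positivity)
  have hL : ‖B *ᵥ x‖ ≤ ‖L‖ * ‖x‖ := L.le_opNorm x
  calc ‖(B ^ n) *ᵥ x‖ = ‖a • (B *ᵥ x) + b • x‖ := by
        rw [hab, add_mulVec, smul_mulVec, smul_mulVec, one_mulVec]
    _ ≤ |a| * ‖B *ᵥ x‖ + |b| * ‖x‖ := by
        refine (norm_add_le _ _).trans ?_
        rw [norm_smul, norm_smul, Real.norm_eq_abs, Real.norm_eq_abs]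
    _ ≤ 2 * (3 / 5) ^ n * (‖L‖ * ‖x‖) + 2 * (3 / 5) ^ n * ‖x‖ := by gcongr
    _ = (2 * ‖L‖ + 2) * (3 / 5) ^ n * ‖x‖ := by ring

theorem tendsto_geometric_mul_const (C M : ℝ) :
    Filter.Tendsto (fun n : ℕ => C * (3 / 5 : ℝ) ^ n * M) Filter.atTop (nhds 0) := by
  simpa using ((tendsto_pow_atTop_nhds_zero_of_lt_one (r := (3 / 5 : ℝ)) (by norm_num)
    (by norm_num)).const_mul C).mul_const M

theorem summable_geometric_succ_mul_const (C M : ℝ) :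
    Summable fun n : ℕ => C * (3 / 5 : ℝ) ^ (n + 1) * M :=
  (((summable_nat_add_iff 1).2 (summable_geometric_of_lt_one (r := (3 / 5 : ℝ)) (by norm_num)
    (by norm_num))).mul_left C).mul_right M

/-- The vector `∑_{i≥1} B^i d_i` with digit sequence `d`. -/
noncomputable def digitSum (B : Matrix (Fin 2) (Fin 2) ℝ) (d : ℕ → Fin 2 → ℝ) : Fin 2 → ℝ :=
  ∑' n, (B ^ (n + 1)) *ᵥ d n

section Digits

variable {B : Matrix (Fin 2) (Fin 2) ℝ} {C M : ℝ}

theorem hasSum_digitSum (hC : 0 ≤ C)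
    (hB : ∀ (n : ℕ) (x : Fin 2 → ℝ), ‖(B ^ n) *ᵥ x‖ ≤ C * (3 / 5) ^ n * ‖x‖)
    {d : ℕ → Fin 2 → ℝ} (hd : ∀ n, ‖d n‖ ≤ M) :
    HasSum (fun n => (B ^ (n + 1)) *ᵥ d n) (digitSum B d) := by
  refine (Summable.of_norm_bounded (summable_geometric_succ_mul_const C M) fun n => ?_).hasSum
  refine (hB _ _).trans ?_
  gcongr
  exact hd n

theorem digitSum_eq (hC : 0 ≤ C)
    (hB : ∀ (n : ℕ) (x : Fin 2 → ℝ), ‖(B ^ n) *ᵥ x‖ ≤ C * (3 / 5) ^ n * ‖x‖)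
    {d : ℕ → Fin 2 → ℝ} (hd : ∀ n, ‖d n‖ ≤ M) :
    digitSum B d = B *ᵥ (digitSum B (fun n => d (n + 1)) + d 0) := by
  have h₁ := (hasSum_nat_add_iff' 1).2 (hasSum_digitSum hC hB hd)
  have h₂ := (hasSum_digitSum hC hB (fun n => hd (n + 1))).mapL
    (Matrix.mulVecLin B).toContinuousLinearMap
  have h₃ : HasSum (fun n => (B ^ (n + 1 + 1)) *ᵥ d (n + 1))
      (B *ᵥ digitSum B (fun n => d (n + 1))) := by
    refine h₂.congr_fun ?_
    intro n
    rw [pow_succ', ← mulVec_mulVec]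
    rfl
  have h₄ := h₁.unique h₃
  rw [mulVec_add, ← h₄, Finset.sum_range_one, zero_add, pow_one, sub_add_cancel]

theorem isCompact_image_digitSum (hC : 0 ≤ C)
    (hB : ∀ (n : ℕ) (x : Fin 2 → ℝ), ‖(B ^ n) *ᵥ x‖ ≤ C * (3 / 5) ^ n * ‖x‖)
    {D : Set (Fin 2 → ℝ)} (hD : IsCompact D) :
    IsCompact (digitSum B '' Set.univ.pi fun _ => D) := by
  obtain ⟨M, hM⟩ := hD.isBounded.exists_norm_le
  refine (isCompact_univ_pi fun _ => hD).image_of_continuousOn ?_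
  refine continuousOn_tsum (u := fun n => C * (3 / 5 : ℝ) ^ (n + 1) * M) (fun n => ?_)
    (summable_geometric_succ_mul_const C M) fun n d hd => ?_
  · exact ((Matrix.mulVecLin (B ^ (n + 1))).toContinuousLinearMap.continuous.comp
      (continuous_apply n)).continuousOn
  · refine (hB _ _).trans ?_
    gcongr
    exact hM _ (hd n trivial)

end Digits

theorem selfAffine_eq_image {A : Matrix (Fin 2) (Fin 2) ℝ} {C : ℝ} (hC : 0 ≤ C)
    (hA : ∀ (n : ℕ) (x : Fin 2 → ℝ), ‖(A⁻¹ ^ n) *ᵥ x‖ ≤ C * (3 / 5) ^ n * ‖x‖)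
    {D : Set (Fin 2 → ℝ)} (hD : IsCompact D) :
    selfAffine A D = digitSum A⁻¹ '' Set.univ.pi fun _ => D := by
  obtain ⟨M, hM⟩ := hD.isBounded.exists_norm_le
  ext x
  constructor
  · rintro ⟨d, hd, hx⟩
    exact ⟨d, fun n _ => hd n, hx.tsum_eq⟩
  · rintro ⟨d, hd, rfl⟩
    exact ⟨d, fun n => hd n trivial, hasSum_digitSum hC hA fun n => hM _ (hd n trivial)⟩

/-- A form of Hata's criterion: a compact set `T = ⋃ d ∈ D, B(T + d)` whose pieces all meet the
piece of a fixed digit is preconnected, if the powers of `B` tend to zero uniformly on `T - T`. -/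
theorem isPreconnected_of_selfSimilar {E : Type*} [NormedAddCommGroup E] (B : E →+ E)
    {T D : Set E} (hT : IsCompact T) {d₀ : E} (hd₀ : d₀ ∈ D)
    (hmaps : ∀ d ∈ D, ∀ y ∈ T, B (y + d) ∈ T)
    (hcover : ∀ x ∈ T, ∃ d ∈ D, ∃ y ∈ T, x = B (y + d))
    (hmeet : ∀ d ∈ D, ∃ x ∈ T, ∃ y ∈ T, B (x + d) = B (y + d₀))
    (hsmall : ∀ δ > 0, ∃ n : ℕ, ∀ x ∈ T, ∀ y ∈ T, ‖B^[n] (x - y)‖ < δ) :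
    IsPreconnected T := by
  have key : ∀ (n : ℕ) (g : E → Bool), (∀ x ∈ T, ∀ y ∈ T,
      (∃ s ∈ T, ∃ t ∈ T, x - y = B^[n] (s - t)) → g x = g y) → ∀ x ∈ T, ∀ y ∈ T, g x = g y := by
    intro n
    induction n with
    | zero => exact fun g hg x hx y hy => hg x hx y hy ⟨x, hx, y, hy, rfl⟩
    | succ n ih =>
      intro g hg
      have hpiece : ∀ d ∈ D, ∀ x ∈ T, ∀ y ∈ T, g (B (x + d)) = g (B (y + d)) := by
        intro d hd
        refine ih (fun x => g (B (x + d))) ?_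
        rintro x hx y hy ⟨s, hs, t, ht, hst⟩
        refine hg _ (hmaps d hd x hx) _ (hmaps d hd y hy) ⟨s, hs, t, ht, ?_⟩
        rw [Function.iterate_succ_apply', ← hst, ← map_sub, add_sub_add_right_eq_sub]
      have hbase : ∀ d ∈ D, ∀ x ∈ T, ∀ y ∈ T, g (B (x + d)) = g (B (y + d₀)) := by
        intro d hd x hx y hy
        obtain ⟨p, hp, q, hq, hpq⟩ := hmeet d hd
        rw [hpiece d hd x hx p hp, hpq, hpiece d₀ hd₀ q hq y hy]
      intro x hx y hy
      obtain ⟨d, hd, x', hx', rfl⟩ := hcover x hx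
      obtain ⟨e, he, y', hy', rfl⟩ := hcover y hy
      rw [hbase d hd x' hx' y' hy', hbase e he y' hy' y' hy']
  refine isPreconnected_of_forall_constant fun g hg => ?_
  let _ : UniformSpace Bool := ⊥
  have hu := hT.uniformContinuousOn_of_continuous hg
  have hmem : {p : Bool × Bool | p.1 = p.2} ∈ uniformity Bool := by
    change _ ∈ Filter.principal _
    intro p hp
    exact hp
  obtain ⟨δ, hδ, h⟩ := (Metric.uniformity_basis_dist.inf_principal _).mem_iff.1 (hu hmem)
  obtain ⟨n, hn⟩ := hsmall δ hδ
  refine key n g ?_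
  rintro x hx y hy ⟨s, hs, t, ht, hst⟩
  refine @h (x, y) ⟨?_, hx, hy⟩
  change dist x y < δ
  rw [dist_eq_norm, hst]
  exact hn s hs t ht

/-- Telescoping of the series `∑ B^{k i} w` for `w = (1 - B^k) u`. -/
theorem hasSum_pow_mul_mulVec {B : Matrix (Fin 2) (Fin 2) ℝ} {C : ℝ} (hC : 0 ≤ C)
    (hB : ∀ (n : ℕ) (x : Fin 2 → ℝ), ‖(B ^ n) *ᵥ x‖ ≤ C * (3 / 5) ^ n * ‖x‖)
    {k : ℕ} (hk : 1 ≤ k) {u w : Fin 2 → ℝ} (hw : w = u - B ^ k *ᵥ u) :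
    HasSum (fun i : ℕ => B ^ (k * i) *ᵥ w) u := by
  have hle : ∀ (i : ℕ) (x : Fin 2 → ℝ), ‖B ^ (k * i) *ᵥ x‖ ≤ C * (3 / 5) ^ i * ‖x‖ := by
    intro i x
    refine (hB _ _).trans ?_
    gcongr C * ?_ * _
    exact pow_le_pow_of_le_one (by norm_num) (by norm_num) (Nat.le_mul_of_pos_left i hk)
  have hs : Summable fun i : ℕ => B ^ (k * i) *ᵥ w :=
    Summable.of_norm_bounded (((summable_geometric_of_lt_one (r := (3 / 5 : ℝ)) (by norm_num)
      (by norm_num)).mul_left C).mul_right ‖w‖) fun i => hle i w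
  have hpart : ∀ n, ∑ i ∈ Finset.range n, B ^ (k * i) *ᵥ w = u - B ^ (k * n) *ᵥ u := by
    intro n
    induction n with
    | zero => simp
    | succ n ih =>
      rw [Finset.sum_range_succ, ih, hw, mulVec_sub, mulVec_mulVec, ← pow_add, mul_add_one]
      abel
  have hlim : Filter.Tendsto (fun n => B ^ (k * n) *ᵥ u) Filter.atTop (nhds 0) :=
    squeeze_zero_norm (fun n => hle n u) (tendsto_geometric_mul_const C ‖u‖)
  refine (hs.hasSum_iff_tendsto_nat).2 ?_
  simp only [hpart]
  simpa using tendsto_const_nhds.sub hlim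

theorem stmt9 (A : Matrix (Fin 2) (Fin 2) ℝ)
    (h : A * A + A + (3 : ℝ) • (1 : Matrix (Fin 2) (Fin 2) ℝ) = 0)
    (v : Fin 2 → ℝ) (hv : LinearIndependent ℝ ![v, A *ᵥ v])
    (D : Set (Fin 2 → ℝ)) (hD : D = {0, v, A *ᵥ v})
    (T : Set (Fin 2 → ℝ)) (hT : T = selfAffine A D) :
    HasSum (fun i : ℕ => A⁻¹ ^ (3 * i) *ᵥ
        (A⁻¹ ^ 2 *ᵥ (-v) + A⁻¹ ^ 3 *ᵥ (v - A *ᵥ v) + A⁻¹ ^ 4 *ᵥ (A *ᵥ v))) v ∧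
    HasSum (fun i : ℕ => A⁻¹ ^ (3 * i) *ᵥ
        (A⁻¹ ^ 1 *ᵥ (-v) + A⁻¹ ^ 2 *ᵥ (v - A *ᵥ v) + A⁻¹ ^ 3 *ᵥ (A *ᵥ v))) (A *ᵥ v) ∧
    v ∈ T - T ∧ (A *ᵥ v) ∈ T - T ∧ IsConnected T := by
  have hAA : A * A = -A - (3 : ℝ) • (1 : Matrix (Fin 2) (Fin 2) ℝ) := by
    linear_combination (norm := module) h
  have hinv : A⁻¹ = (-(1 / 3) : ℝ) • (A + 1) := by
    refine Matrix.inv_eq_right_inv ?_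
    rw [mul_smul_comm, mul_add, mul_one, hAA]
    module
  have hAB : A⁻¹ * A = 1 := by
    rw [hinv, smul_mul_assoc, add_mul, one_mul, hAA]
    module
  have hquad : (3 : ℝ) • (A⁻¹ * A⁻¹) + A⁻¹ + 1 = 0 := by
    rw [hinv, smul_mul_assoc, mul_smul_comm, mul_add, add_mul, one_mul, mul_one, hAA]
    module
  obtain ⟨C, hC, hdecay⟩ := exists_norm_pow_mulVec_le hquad
  set B := A⁻¹
  have hBB : B ^ 2 = (-(1 / 3) : ℝ) • B + (-(1 / 3) : ℝ) • (1 : Matrix (Fin 2) (Fin 2) ℝ) := by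
    rw [sq]
    linear_combination (norm := module) (1 / 3 : ℝ) • hquad
  have hBA : ∀ x, B *ᵥ (A *ᵥ x) = x := fun x => by rw [mulVec_mulVec, hAB, one_mulVec]
  have hcube : ∀ x, B ^ 3 *ᵥ x = (-(2 / 9) : ℝ) • B *ᵥ x + (1 / 9 : ℝ) • x := by
    intro x
    have : B ^ 3 = (-(2 / 9) : ℝ) • B + (1 / 9 : ℝ) • (1 : Matrix (Fin 2) (Fin 2) ℝ) := by
      rw [pow_succ, hBB, add_mul, smul_mul_assoc, smul_mul_assoc, one_mul, ← sq, hBB]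
      module
    rw [this, add_mulVec, smul_mulVec, smul_mulVec, one_mulVec]
  have hsq : ∀ x, B ^ 2 *ᵥ x = (-(1 / 3) : ℝ) • B *ᵥ x + (-(1 / 3) : ℝ) • x := by
    intro x
    rw [hBB, add_mulVec, smul_mulVec, smul_mulVec, one_mulVec]
  have hAv : A *ᵥ v = -(3 : ℝ) • B *ᵥ v - v := by
    rw [hinv, smul_mulVec, add_mulVec, one_mulVec]
    module
  have hperiod : B ^ 1 *ᵥ (-v) + B ^ 2 *ᵥ (v - A *ᵥ v) + B ^ 3 *ᵥ (A *ᵥ v) =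
      A *ᵥ v - B ^ 3 *ᵥ (A *ᵥ v) := by
    simp only [hcube, hsq, pow_one, mulVec_neg, mulVec_sub, hBA]
    rw [hAv]
    module
  have hperiod' : B ^ 2 *ᵥ (-v) + B ^ 3 *ᵥ (v - A *ᵥ v) + B ^ 4 *ᵥ (A *ᵥ v) =
      v - B ^ 3 *ᵥ v := by
    rw [pow_succ B 3, ← mulVec_mulVec]
    simp only [hcube, hsq, mulVec_neg, mulVec_sub, hBA]
    rw [hAv]
    module
  have hDc : IsCompact D := by
    rw [hD]
    exact (Set.toFinite _).isCompact
  have h0D : (0 : Fin 2 → ℝ) ∈ D := by simp [hD]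
  have hvD : v ∈ D := by simp [hD]
  have hAvD : A *ᵥ v ∈ D := by simp [hD]
  obtain ⟨M, hM⟩ := hDc.isBounded.exists_norm_le
  rw [selfAffine_eq_image hC hdecay hDc] at hT
  have hTc : IsCompact T := hT ▸ isCompact_image_digitSum hC hdecay hDc
  have hmaps : ∀ d ∈ D, ∀ y ∈ T, B *ᵥ (y + d) ∈ T := by
    rw [hT]
    rintro d hd _ ⟨e, he, rfl⟩
    have he' : ∀ n, (Nat.casesOn n d e : Fin 2 → ℝ) ∈ D := by
      rintro (_ | n)
      exacts [hd, he n trivial]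
    exact ⟨fun n => Nat.casesOn n d e, fun n _ => he' n,
      digitSum_eq hC hdecay fun n => hM _ (he' n)⟩
  have hcover : ∀ x ∈ T, ∃ d ∈ D, ∃ y ∈ T, x = B *ᵥ (y + d) := by
    rw [hT]
    rintro _ ⟨e, he, rfl⟩
    exact ⟨e 0, he 0 trivial, _, ⟨fun n => e (n + 1), fun n _ => he (n + 1) trivial, rfl⟩,
      digitSum_eq hC hdecay fun n => hM _ (he n trivial)⟩
  have hperiodic : ∀ a ∈ D, ∀ b ∈ D, ∀ c ∈ D,
      ∃ t ∈ T, t = B *ᵥ (B *ᵥ (B *ᵥ (t + c) + b) + a) := by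
    intro a ha b hb c hc
    set e : ℕ → Fin 2 → ℝ := fun n => ![a, b, c] (Fin.ofNat 3 n) with he
    have heD : ∀ n, e n ∈ D := by
      intro n
      have : ∀ i : Fin 3, ![a, b, c] i ∈ D := by
        intro i
        fin_cases i
        exacts [ha, hb, hc]
      exact this _
    have hshift : (fun n => e (n + 1 + 1 + 1)) = e := by
      funext n
      have : Fin.ofNat 3 (n + 1 + 1 + 1) = Fin.ofNat 3 n := by
        ext
        simp [Fin.ofNat, add_assoc]
      simp only [he, this]
    refine ⟨digitSum B e, hT ▸ ⟨e, fun n _ => heD n, rfl⟩, ?_⟩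
    conv_lhs =>
      rw [digitSum_eq hC hdecay fun n => hM _ (heD n),
        digitSum_eq hC hdecay fun n => hM _ (heD (n + 1)),
        digitSum_eq hC hdecay fun n => hM _ (heD (n + 1 + 1)), hshift]
    rfl
  have hAvT : ∃ t ∈ T, ∃ t' ∈ T, t - t' = A *ᵥ v := by
    obtain ⟨t, htT, ht⟩ := hperiodic 0 h0D v hvD (A *ᵥ v) hAvD
    obtain ⟨t', htT', ht'⟩ := hperiodic v hvD (A *ᵥ v) hAvD 0 h0D
    refine ⟨t, htT, t', htT', ?_⟩
    have hw : B ^ 1 *ᵥ (-v) + B ^ 2 *ᵥ (v - A *ᵥ v) + B ^ 3 *ᵥ (A *ᵥ v) =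
        (t - t') - B ^ 3 *ᵥ (t - t') := by
      have h2 : ∀ x, B *ᵥ (B *ᵥ x) = B ^ 2 *ᵥ x := fun x => by rw [mulVec_mulVec, sq]
      have h3 : ∀ x, B *ᵥ (B ^ 2 *ᵥ x) = B ^ 3 *ᵥ x := fun x => by
        rw [mulVec_mulVec, ← pow_succ']
      simp only [mulVec_add, h3, h2, mulVec_zero] at ht ht'
      simp only [mulVec_sub, mulVec_neg, pow_one]
      linear_combination (norm := module) ht' - ht
    exact (hasSum_pow_mul_mulVec hC hdecay (by norm_num) hw).unique
      (hasSum_pow_mul_mulVec hC hdecay (by norm_num) hperiod)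
  have hvT : ∃ t ∈ T, ∃ t' ∈ T, t - t' = v := by
    obtain ⟨t, ht, t', ht', htt⟩ := hAvT
    refine ⟨_, hmaps 0 h0D t ht, _, hmaps 0 h0D t' ht', ?_⟩
    rw [← mulVec_sub, add_zero, add_zero, htt, hBA]
  refine ⟨hasSum_pow_mul_mulVec hC hdecay (by norm_num) hperiod',
    hasSum_pow_mul_mulVec hC hdecay (by norm_num) hperiod, Set.mem_sub.2 hvT, Set.mem_sub.2 hAvT,
    hvT.imp fun _ ht => ht.1, ?_⟩
  refine isPreconnected_of_selfSimilar (Matrix.mulVecLin B).toAddMonoidHom hTc h0D hmaps hcover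
    ?_ ?_
  · have hmeet : ∀ d, (∃ t ∈ T, ∃ t' ∈ T, t - t' = d) →
        ∃ x ∈ T, ∃ y ∈ T, B *ᵥ (x + d) = B *ᵥ (y + 0) := by
      rintro d ⟨t, ht, t', ht', rfl⟩
      exact ⟨t', ht', t, ht, by simp⟩
    have ht₀ := hvT.imp fun _ ht => ht.1
    intro d hd
    refine hmeet d ?_
    rw [hD] at hd
    obtain rfl | rfl | rfl := hd
    · exact ht₀.elim fun t ht => ⟨t, ht, t, ht, sub_self t⟩
    · exact hvT
    · exact hAvT
  · intro δ hδ
    obtain ⟨R, hR⟩ := hTc.isBounded.exists_norm_le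
    obtain ⟨n, hn⟩ := ((tendsto_geometric_mul_const C (R + R)).eventually_lt_const hδ).exists
    refine ⟨n, fun x hx y hy => ?_⟩
    have hiter : ∀ (n : ℕ) (z : Fin 2 → ℝ),
        (Matrix.mulVecLin B).toAddMonoidHom^[n] z = B ^ n *ᵥ z := by
      intro n z
      induction n with
      | zero => simp
      | succ n ih =>
        rw [Function.iterate_succ_apply', ih, pow_succ', ← mulVec_mulVec]
        rfl
    rw [hiter]
    refine lt_of_le_of_lt ((hdecay n _).trans ?_) hn
    gcongr
    exact (norm_sub_le x y).trans (add_le_add (hR x hx) (hR y hy))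
end

section
/- Let A, B be expanding 2×2 integer matrices with characteristic polynomials x² + px + q and x² − px + q respectively, and let v, w be vectors with {v, Av} and {w, Bw} linearly independent. For digit sets 𝒟 = {c_i Av + d_i v : i = 0,…,|q|−1} and 𝒟' = {−c_i Bw + d_i w : i = 0,…,|q|−1} (same integer coefficients c_i, d_i), the self-affine set T(A,𝒟) is connected if and only if T(B,𝒟') is connected. -/
open Matrix Polynomial

/-- All (complex) eigenvalues of `A` have modulus strictly larger than `1`. -/
def IsExpandingMat (A : Matrix (Fin 2) (Fin 2) ℝ) : Prop :=
  ∀ μ ∈ spectrum ℂ (A.map (algebraMap ℝ ℂ)), 1 < ‖μ‖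

section SelfAffine

open Set Filter Topology
open scoped Matrix.Norms.Operator NNReal ENNReal

theorem spectrum.summable_norm_pow {R : Type*} [NormedRing R] [NormedAlgebra ℂ R]
    [CompleteSpace R] [Nontrivial R] {a : R} (ha : ∀ z ∈ spectrum ℂ a, ‖z‖ < 1) :
    Summable fun n => ‖a ^ n‖ := by
  have hlt : spectralRadius ℂ a < (1 : ℝ≥0) :=
    spectrum.spectralRadius_lt_of_forall_lt a fun z hz => ha z hz
  obtain ⟨r, har, hr⟩ := ENNReal.lt_iff_exists_nnreal_btwn.1 hlt
  have hr1 : r < 1 := by exact_mod_cast hr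
  have hev := (spectrum.pow_nnnorm_pow_one_div_tendsto_nhds_spectralRadius a).eventually_lt_const har
  refine Summable.of_norm_bounded_eventually_nat (g := fun n => (r : ℝ) ^ n)
    (summable_geometric_of_lt_one r.2 hr1) ?_
  filter_upwards [hev, eventually_gt_atTop 0] with n hn hn0
  have hpow : (‖a ^ n‖₊ : ℝ≥0∞) ≤ (r : ℝ≥0∞) ^ n := by
    have := ENNReal.rpow_le_rpow hn.le (Nat.cast_nonneg (α := ℝ) n)
    rwa [← ENNReal.rpow_mul, one_div_mul_cancel (by positivity), ENNReal.rpow_one,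
      ENNReal.rpow_natCast] at this
  rw [norm_norm]
  exact_mod_cast hpow

namespace IsExpandingMat

variable {A : Matrix (Fin 2) (Fin 2) ℝ}

theorem isUnit (hA : IsExpandingMat A) : IsUnit A := by
  have h0 : (0 : ℂ) ∉ spectrum ℂ (A.map (algebraMap ℝ ℂ)) := fun h => absurd (hA 0 h) (by simp)
  rw [spectrum.zero_notMem_iff, Matrix.isUnit_iff_isUnit_det, isUnit_iff_ne_zero] at h0
  rw [Matrix.isUnit_iff_isUnit_det, isUnit_iff_ne_zero]
  intro h
  apply h0
  have := RingHom.map_det (algebraMap ℝ ℂ) A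
  rw [h, map_zero] at this
  exact this.symm

theorem summable_norm_inv_pow (hA : IsExpandingMat A) : Summable fun n => ‖A⁻¹ ^ n‖ := by
  obtain ⟨u, rfl⟩ := hA.isUnit
  let φ : Matrix (Fin 2) (Fin 2) ℝ →+* Matrix (Fin 2) (Fin 2) ℂ := (algebraMap ℝ ℂ).mapMatrix
  have hφ : ∀ M, ‖φ M‖ = ‖M‖ := fun M => by
    simp [φ, Matrix.linfty_opNorm_def]
  have key : Summable fun n => ‖(((Units.map φ.toMonoidHom u)⁻¹ : (Matrix (Fin 2) (Fin 2) ℂ)ˣ) :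
      Matrix (Fin 2) (Fin 2) ℂ) ^ n‖ := by
    refine spectrum.summable_norm_pow fun z hz => ?_
    rw [← spectrum.map_inv] at hz
    have := hA _ hz
    rw [norm_inv] at this
    exact (one_lt_inv_iff₀.1 this).2
  refine key.congr fun n => ?_
  rw [← Matrix.coe_units_inv, ← hφ, map_pow]
  rfl

end IsExpandingMat

variable {A : Matrix (Fin 2) (Fin 2) ℝ} {D : Set (Fin 2 → ℝ)}

theorem inv_neg_matrix (A : Matrix (Fin 2) (Fin 2) ℝ) : (-A)⁻¹ = -A⁻¹ := by
  simp [Matrix.inv_def, Matrix.adjugate_fin_two, Matrix.det_fin_two]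

theorem norm_pow_mulVec_le (M : Matrix (Fin 2) (Fin 2) ℝ) {C : ℝ} (hC : ∀ x ∈ D, ‖x‖ ≤ C)
    {a : ℕ → Fin 2 → ℝ} (ha : ∀ n, a n ∈ D) (n : ℕ) :
    ‖(M ^ (n + 1)) *ᵥ a n‖ ≤ ‖M ^ (n + 1)‖ * C :=
  (Matrix.linfty_opNorm_mulVec _ _).trans
    (mul_le_mul_of_nonneg_left (hC _ (ha n)) (norm_nonneg _))

theorem summable_pow_mulVec (hA : Summable fun n => ‖A⁻¹ ^ n‖) (hD : Bornology.IsBounded D)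
    {a : ℕ → Fin 2 → ℝ} (ha : ∀ n, a n ∈ D) :
    Summable fun n => (A⁻¹ ^ (n + 1)) *ᵥ a n := by
  obtain ⟨C, hC⟩ := hD.exists_norm_le
  exact Summable.of_norm_bounded (((summable_nat_add_iff 1).2 hA).mul_right C)
    (norm_pow_mulVec_le _ hC ha)

theorem continuous_mulVec_const (M : Matrix (Fin 2) (Fin 2) ℝ) : Continuous fun x => M *ᵥ x :=
  continuous_const.matrix_mulVec continuous_id

theorem hasSum_mulVec (M : Matrix (Fin 2) (Fin 2) ℝ) {f : ℕ → Fin 2 → ℝ} {x : Fin 2 → ℝ}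
    (hf : HasSum f x) : HasSum (fun n => M *ᵥ f n) (M *ᵥ x) :=
  hf.map M.mulVecLin.toAddMonoidHom (continuous_mulVec_const M)

theorem isCompact_selfAffine (hA : Summable fun n => ‖A⁻¹ ^ n‖) (hD : IsCompact D) :
    IsCompact (selfAffine A D) := by
  obtain ⟨C, hC⟩ := hD.isBounded.exists_norm_le
  have himage : selfAffine A D =
      (fun a : ℕ → Fin 2 → ℝ => ∑' n, (A⁻¹ ^ (n + 1)) *ᵥ a n) '' pi univ fun _ => D := by
    ext x
    constructor
    · rintro ⟨a, ha, hx⟩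
      exact ⟨a, fun n _ => ha n, hx.tsum_eq⟩
    · rintro ⟨a, ha, rfl⟩
      exact ⟨a, fun n => ha n trivial,
        (summable_pow_mulVec hA hD.isBounded fun n => ha n trivial).hasSum⟩
  rw [himage]
  refine (isCompact_univ_pi fun _ => hD).image_of_continuousOn ?_
  refine continuousOn_tsum (fun n => ?_) (((summable_nat_add_iff 1).2 hA).mul_right C)
    fun n a ha => norm_pow_mulVec_le _ hC (fun n => ha n trivial) n
  exact ((continuous_mulVec_const _).comp (continuous_apply n)).continuousOn

theorem selfAffine_nonempty (hA : Summable fun n => ‖A⁻¹ ^ n‖) (hD : D.Nonempty) :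
    (selfAffine A D).Nonempty := by
  obtain ⟨d, hd⟩ := hD
  obtain ⟨x, hx⟩ := summable_pow_mulVec hA (Bornology.isBounded_singleton (x := d))
    (a := fun _ => d) fun _ => rfl
  exact ⟨x, fun _ => d, fun _ => hd, hx⟩

theorem mem_selfAffine_iff (hA : Summable fun n => ‖A⁻¹ ^ n‖) (hD : Bornology.IsBounded D)
    {x : Fin 2 → ℝ} :
    x ∈ selfAffine A D ↔ ∃ d ∈ D, ∃ y ∈ selfAffine A D, x = A⁻¹ *ᵥ (d + y) := by
  have hshift : ∀ (a : ℕ → Fin 2 → ℝ) (y : Fin 2 → ℝ),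
      HasSum (fun n => (A⁻¹ ^ (n + 1)) *ᵥ a (n + 1)) y →
      HasSum (fun n => (A⁻¹ ^ (n + 1)) *ᵥ a n) (A⁻¹ *ᵥ (a 0 + y)) := by
    intro a y hy
    have h := hasSum_mulVec A⁻¹ hy
    simp only [Matrix.mulVec_mulVec, ← pow_succ'] at h
    have := HasSum.zero_add (f := fun n => (A⁻¹ ^ (n + 1)) *ᵥ a n) h
    simpa [Matrix.mulVec_add] using this
  constructor
  · rintro ⟨a, ha, hx⟩
    obtain ⟨y, hy⟩ := summable_pow_mulVec hA hD (a := fun n => a (n + 1)) fun n => ha _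
    exact ⟨a 0, ha 0, y, ⟨fun n => a (n + 1), fun n => ha (n + 1), hy⟩, hx.unique (hshift a y hy)⟩
  · rintro ⟨d, hd, y, ⟨a, ha, hy⟩, rfl⟩
    let a' : ℕ → Fin 2 → ℝ := fun n => Nat.casesOn n d a
    have ha' : ∀ n, a' n ∈ D := by
      rintro (_ | n)
      exacts [hd, ha n]
    exact ⟨a', ha', hshift a' y hy⟩

/-- The pieces of the self-affine set that belong to the digits `d` and `d'` meet. -/
def DigitsMeet (A : Matrix (Fin 2) (Fin 2) ℝ) (D : Set (Fin 2 → ℝ)) (d d' : Fin 2 → ℝ) : Prop :=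
  ∃ x ∈ selfAffine A D, ∃ y ∈ selfAffine A D, d + x = d' + y

/-- The graph on the digit set whose edges join digits with meeting pieces is connected:
a nonempty set of digits that is closed under adjacency contains all digits. -/
def DigitsConnected (A : Matrix (Fin 2) (Fin 2) ℝ) (D : Set (Fin 2 → ℝ)) : Prop :=
  ∀ E ⊆ D, E.Nonempty → (∀ d ∈ E, ∀ d' ∈ D, DigitsMeet A D d d' → d' ∈ E) → D ⊆ E

theorem DigitsMeet.neg (hA : Summable fun n => ‖(-A)⁻¹ ^ n‖) (hD : Bornology.IsBounded D)
    {d d' : Fin 2 → ℝ} (h : DigitsMeet A D d d') : DigitsMeet (-A) D d d' := by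
  obtain ⟨x, ⟨a, ha, hx⟩, y, ⟨b, hb, hy⟩, hxy⟩ := h
  let a' : ℕ → Fin 2 → ℝ := fun n => if Even n then b n else a n
  let b' : ℕ → Fin 2 → ℝ := fun n => if Even n then a n else b n
  have ha' : ∀ n, a' n ∈ D := fun n => by
    simp only [a']; split_ifs
    exacts [hb n, ha n]
  have hb' : ∀ n, b' n ∈ D := fun n => by
    simp only [b']; split_ifs
    exacts [ha n, hb n]
  obtain ⟨x', hx'⟩ := summable_pow_mulVec hA hD ha'
  obtain ⟨y', hy'⟩ := summable_pow_mulVec hA hD hb'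
  refine ⟨x', ⟨a', ha', hx'⟩, y', ⟨b', hb', hy'⟩, ?_⟩
  have hsub : x' - y' = x - y := by
    refine (hx'.sub hy').unique ?_
    convert hx.sub hy using 2 with n
    have hneg := inv_neg_matrix A
    simp only [a', b', hneg]
    split_ifs with hn
    · rw [hn.add_one.neg_pow, Matrix.neg_mulVec, Matrix.neg_mulVec]
      abel
    · rw [(Nat.not_even_iff_odd.1 hn).add_one.neg_pow]
  calc d + x' = d + x + (x' - y') - (x - y) + (y' - y) := by abel
    _ = d' + y' := by rw [hsub, hxy]; abel

theorem DigitsConnected.neg (hA : Summable fun n => ‖A⁻¹ ^ n‖) (hD : Bornology.IsBounded D)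
    (h : DigitsConnected (-A) D) : DigitsConnected A D := by
  intro E hED hE hcl
  refine h E hED hE fun d hd d' hd' hm => hcl d hd d' hd' ?_
  have := DigitsMeet.neg (A := -A) (by rwa [neg_neg]) hD hm
  rwa [neg_neg] at this

theorem digitsConnected_of_isConnected (hA : Summable fun n => ‖A⁻¹ ^ n‖) (hu : IsUnit A)
    (hD : D.Finite) (h : IsConnected (selfAffine A D)) : DigitsConnected A D := by
  intro E hED hE hcl
  by_contra hDE
  obtain ⟨d₀, hd₀, hd₀E⟩ := not_subset.1 hDE
  have hcomp := isCompact_selfAffine hA hD.isCompact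
  let P : Set (Fin 2 → ℝ) → Set (Fin 2 → ℝ) := fun F =>
    ⋃ d ∈ F, (fun y => A⁻¹ *ᵥ (d + y)) '' selfAffine A D
  have hP : ∀ F ⊆ D, IsClosed (P F) := fun F hF =>
    ((hD.subset hF).isCompact_biUnion fun d _ => hcomp.image
      ((continuous_mulVec_const _).comp (continuous_const.add continuous_id))).isClosed
  have hmeet : ∀ F ⊆ D, F.Nonempty → (selfAffine A D ∩ P F).Nonempty := by
    rintro F hF ⟨d, hd⟩
    obtain ⟨y, hy⟩ := h.nonempty
    exact ⟨_, (mem_selfAffine_iff hA hD.isBounded).2 ⟨d, hF hd, y, hy, rfl⟩,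
      mem_biUnion hd ⟨y, hy, rfl⟩⟩
  have hcover : selfAffine A D ⊆ P E ∪ P (D \ E) := by
    intro x hx
    obtain ⟨d, hd, y, hy, rfl⟩ := (mem_selfAffine_iff hA hD.isBounded).1 hx
    by_cases hdE : d ∈ E
    · exact Or.inl (mem_biUnion hdE ⟨y, hy, rfl⟩)
    · exact Or.inr (mem_biUnion (⟨hd, hdE⟩ : d ∈ D \ E) ⟨y, hy, rfl⟩)
  obtain ⟨z, -, hz, hz'⟩ := isPreconnected_closed_iff.1 h.isPreconnected _ _ (hP E hED)
    (hP (D \ E) sdiff_subset) hcover (hmeet E hED hE)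
    (hmeet _ sdiff_subset ⟨d₀, hd₀, hd₀E⟩)
  simp only [P, mem_iUnion, mem_image] at hz hz'
  obtain ⟨d, hd, x, hx, rfl⟩ := hz
  obtain ⟨d', hd', y, hy, hxy⟩ := hz'
  have hinj := Matrix.mulVec_injective_of_isUnit (Matrix.isUnit_nonsing_inv_iff.2 hu)
  exact hd'.2 (hcl d hd d' hd'.1 ⟨x, hx, y, hy, (hinj hxy).symm⟩)

theorem selfAffine_subset_of_digitsConnected (hA : Summable fun n => ‖A⁻¹ ^ n‖)
    (hD : Bornology.IsBounded D) (h : DigitsConnected A D) (n : ℕ) (S : Set (Fin 2 → ℝ))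
    (hST : (selfAffine A D ∩ S).Nonempty)
    (hS : ∀ x ∈ selfAffine A D, ∀ y ∈ selfAffine A D, ∀ s ∈ selfAffine A D, ∀ t ∈ selfAffine A D,
      x ∈ S → x - y = (A⁻¹ ^ n) *ᵥ (s - t) → y ∈ S) :
    selfAffine A D ⊆ S := by
  induction n generalizing S with
  | zero =>
    obtain ⟨x, hx, hxS⟩ := hST
    exact fun y hy => hS x hx y hy x hx y hy hxS (by simp)
  | succ n ih =>
    have hmem : ∀ d ∈ D, ∀ y ∈ selfAffine A D, A⁻¹ *ᵥ (d + y) ∈ selfAffine A D :=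
      fun d hd y hy => (mem_selfAffine_iff hA hD).2 ⟨d, hd, y, hy, rfl⟩
    have hpiece : ∀ d ∈ D, ∀ y ∈ selfAffine A D, A⁻¹ *ᵥ (d + y) ∈ S →
        ∀ z ∈ selfAffine A D, A⁻¹ *ᵥ (d + z) ∈ S := by
      intro d hd y hy hyS
      refine ih {z | A⁻¹ *ᵥ (d + z) ∈ S} ⟨y, hy, hyS⟩ ?_
      intro x hx y hy s hs t ht hxS hxy
      refine hS _ (hmem d hd x hx) _ (hmem d hd y hy) s hs t ht hxS ?_
      rw [← Matrix.mulVec_sub, add_sub_add_left_eq_sub, hxy, Matrix.mulVec_mulVec, pow_succ']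
    have hall : D ⊆ {d | d ∈ D ∧ ∀ z ∈ selfAffine A D, A⁻¹ *ᵥ (d + z) ∈ S} := by
      refine h _ (fun d hd => hd.1) ?_ ?_
      · obtain ⟨x, hx, hxS⟩ := hST
        obtain ⟨d, hd, y, hy, rfl⟩ := (mem_selfAffine_iff hA hD).1 hx
        exact ⟨d, hd, hpiece d hd y hy hxS⟩
      · rintro d ⟨hd, hdS⟩ d' hd' ⟨x, hx, y, hy, hxy⟩
        exact ⟨hd', hpiece d' hd' y hy (hxy ▸ hdS x hx)⟩
    intro x hx
    obtain ⟨d, hd, y, hy, rfl⟩ := (mem_selfAffine_iff hA hD).1 hx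
    exact (hall hd).2 y hy

theorem isConnected_of_digitsConnected (hA : Summable fun n => ‖A⁻¹ ^ n‖)
    (hD : IsCompact D) (hne : D.Nonempty) (h : DigitsConnected A D) :
    IsConnected (selfAffine A D) := by
  have hcomp := isCompact_selfAffine hA hD
  refine ⟨selfAffine_nonempty hA hne, ?_⟩
  rw [isPreconnected_iff_subset_of_fully_disjoint_closed hcomp.isClosed]
  intro U V hU hV hUV hdisj
  by_contra! hnot
  obtain ⟨v, hv, hvU⟩ := not_subset.1 hnot.1
  obtain ⟨u, hu, huV⟩ := not_subset.1 hnot.2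
  have huU : u ∈ U := (hUV hu).resolve_right huV
  obtain ⟨r, hr, hsep⟩ := Metric.exists_pos_forall_lt_edist (hcomp.inter_right hU) hV
    (hdisj.mono_left inter_subset_right)
  obtain ⟨C, hC⟩ := hcomp.isBounded.exists_norm_le
  have htend : Tendsto (fun n => ‖A⁻¹ ^ n‖ * (C + C)) atTop (𝓝 0) := by
    simpa using hA.tendsto_atTop_zero.mul_const (C + C)
  obtain ⟨n, hn⟩ := (htend.eventually_lt_const (NNReal.coe_pos.2 hr)).exists
  refine hvU (selfAffine_subset_of_digitsConnected hA hD.isBounded h n U ⟨u, hu, huU⟩ ?_ hv)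
  intro x hx y hy s hs t ht hxU hxy
  refine (hUV hy).resolve_right fun hyV => ?_
  have hlt := hsep x ⟨hx, hxU⟩ y hyV
  have hle : dist x y ≤ r := by
    rw [dist_eq_norm, hxy]
    refine ((Matrix.linfty_opNorm_mulVec _ _).trans (mul_le_mul_of_nonneg_left
      ((norm_sub_le _ _).trans (add_le_add (hC s hs) (hC t ht))) (norm_nonneg _))).trans hn.le
  rw [edist_nndist, ENNReal.coe_lt_coe] at hlt
  exact absurd hle (not_le.2 hlt)

theorem summable_norm_neg_inv_pow (hA : Summable fun n => ‖A⁻¹ ^ n‖) :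
    Summable fun n => ‖(-A)⁻¹ ^ n‖ := by
  refine hA.congr fun n => ?_
  rw [inv_neg_matrix]
  rcases n.even_or_odd with hn | hn
  · rw [hn.neg_pow]
  · rw [hn.neg_pow, norm_neg]

theorem IsExpandingMat.isConnected_selfAffine_neg_iff (hA : IsExpandingMat A) (hD : D.Finite)
    (hne : D.Nonempty) : IsConnected (selfAffine (-A) D) ↔ IsConnected (selfAffine A D) := by
  have hs := hA.summable_norm_inv_pow
  have hs' := summable_norm_neg_inv_pow hs
  constructor
  · intro h
    exact isConnected_of_digitsConnected hs hD.isCompact hne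
      ((digitsConnected_of_isConnected hs' hA.isUnit.neg hD h).neg hs hD.isBounded)
  · intro h
    refine isConnected_of_digitsConnected hs' hD.isCompact hne
      (DigitsConnected.neg hs' hD.isBounded ?_)
    rw [neg_neg]
    exact digitsConnected_of_isConnected hs hA.isUnit hD h

theorem image_selfAffine {B : Matrix (Fin 2) (Fin 2) ℝ} (φ : (Fin 2 → ℝ) ≃L[ℝ] (Fin 2 → ℝ))
    (hA : IsUnit A) (hB : IsUnit B) (h : ∀ x, φ (A *ᵥ x) = B *ᵥ φ x) :
    φ '' selfAffine A D = selfAffine B (φ '' D) := by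
  have hinv : ∀ x, φ (A⁻¹ *ᵥ x) = B⁻¹ *ᵥ φ x := by
    intro x
    have := h (A⁻¹ *ᵥ x)
    rw [Matrix.mulVec_mulVec, Matrix.mul_nonsing_inv _ ((Matrix.isUnit_iff_isUnit_det _).1 hA),
      Matrix.one_mulVec] at this
    rw [this, Matrix.mulVec_mulVec, Matrix.nonsing_inv_mul _ ((Matrix.isUnit_iff_isUnit_det _).1 hB),
      Matrix.one_mulVec]
  have hpow : ∀ n x, φ ((A⁻¹ ^ n) *ᵥ x) = (B⁻¹ ^ n) *ᵥ φ x := by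
    intro n
    induction n with
    | zero => simp
    | succ n ih =>
      intro x
      rw [pow_succ, pow_succ, ← Matrix.mulVec_mulVec, ← Matrix.mulVec_mulVec, ih, hinv]
  ext x
  constructor
  · rintro ⟨x, ⟨a, ha, hx⟩, rfl⟩
    refine ⟨fun n => φ (a n), fun n => mem_image_of_mem _ (ha n), ?_⟩
    simpa only [hpow] using φ.hasSum'.2 hx
  · rintro ⟨b, hb, hx⟩
    choose a ha hab using hb
    refine ⟨φ.symm x, ⟨a, ha, ?_⟩, φ.apply_symm_apply x⟩
    rw [← φ.hasSum', φ.apply_symm_apply]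
    simpa only [hpow, hab] using hx

theorem mulVec_mulVec_of_charpoly_eq {p q : ℝ} (hA : A.charpoly = X ^ 2 + C p * X + C q)
    (v : Fin 2 → ℝ) : A *ᵥ (A *ᵥ v) = -(p • (A *ᵥ v)) - q • v := by
  have h : A * A + p • A + q • (1 : Matrix (Fin 2) (Fin 2) ℝ) = 0 := by
    have := Matrix.aeval_self_charpoly A
    rw [hA] at this
    simpa [pow_two, Algebra.algebraMap_eq_smul_one] using this
  have h' := congrArg (fun M => M *ᵥ v) h
  simp only [Matrix.add_mulVec, Matrix.smul_mulVec, Matrix.one_mulVec, Matrix.zero_mulVec,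
    ← Matrix.mulVec_mulVec] at h'
  linear_combination h'

end SelfAffine

theorem stmt16 (A B : Matrix (Fin 2) (Fin 2) ℝ)
    (hintA : IsIntMat A) (hintB : IsIntMat B)
    (hexpA : IsExpandingMat A) (hexpB : IsExpandingMat B)
    (p q : ℤ) (hq : q ≠ 0)
    (hcharA : A.charpoly = X ^ 2 + C (p : ℝ) * X + C (q : ℝ))
    (hcharB : B.charpoly = X ^ 2 - C (p : ℝ) * X + C (q : ℝ))
    (v w : Fin 2 → ℝ)
    (hv : LinearIndependent ℝ ![v, A *ᵥ v])
    (hw : LinearIndependent ℝ ![w, B *ᵥ w])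
    (c d : ℕ → ℤ)
    (D D' : Set (Fin 2 → ℝ))
    (hD : D = {x | ∃ i < q.natAbs, x = (c i : ℝ) • (A *ᵥ v) + (d i : ℝ) • v})
    (hD' : D' = {x | ∃ i < q.natAbs, x = -((c i : ℝ) • (B *ᵥ w)) + (d i : ℝ) • w}) :
    IsConnected (selfAffine A D) ↔ IsConnected (selfAffine B D') := by
  have hA2 := mulVec_mulVec_of_charpoly_eq hcharA v
  have hB2 := mulVec_mulVec_of_charpoly_eq (p := -p) (q := q) (hcharB.trans (by simp; ring)) w
  let bv := basisOfLinearIndependentOfCardEqFinrank hv (by simp)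
  let bw := basisOfLinearIndependentOfCardEqFinrank hw (by simp)
  let φ := ((bv.equiv (bw.unitsSMul ![1, -1]) (Equiv.refl _))).toContinuousLinearEquiv
  have hbv0 : bv 0 = v := by simp [bv]
  have hbv1 : bv 1 = A *ᵥ v := by
    rw [coe_basisOfLinearIndependentOfCardEqFinrank, Matrix.cons_val_one, Matrix.cons_val_fin_one]
  have hφ : ∀ i, φ (bv i) = (![1, -1] : Fin 2 → ℝˣ) i • ![w, B *ᵥ w] i := fun i => by
    rw [← coe_basisOfLinearIndependentOfCardEqFinrank hw (by simp), ← Module.Basis.unitsSMul_apply]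
    exact bv.equiv_apply i (bw.unitsSMul ![1, -1]) (Equiv.refl _)
  have hφv : φ v = w := by
    rw [← hbv0, hφ]
    exact one_smul _ _
  have hφAv : φ (A *ᵥ v) = -(B *ᵥ w) := by
    rw [← hbv1, hφ]
    exact (Units.neg_smul _ _).trans (congrArg _ (one_smul _ _))
  have hcomm : ∀ x, φ ((-A) *ᵥ x) = B *ᵥ φ x := by
    have hlin : (φ : (Fin 2 → ℝ) →ₗ[ℝ] (Fin 2 → ℝ)) ∘ₗ (-A).mulVecLin =
        B.mulVecLin ∘ₗ (φ : (Fin 2 → ℝ) →ₗ[ℝ] (Fin 2 → ℝ)) := by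
      refine bv.ext fun i => ?_
      change φ ((-A) *ᵥ bv i) = B *ᵥ φ (bv i)
      rw [Matrix.neg_mulVec, map_neg]
      fin_cases i
      · change -φ (A *ᵥ bv 0) = B *ᵥ φ (bv 0)
        rw [hbv0, hφv, hφAv, neg_neg]
      · change -φ (A *ᵥ bv 1) = B *ᵥ φ (bv 1)
        rw [hbv1, hA2, hφAv, Matrix.mulVec_neg, hB2, map_sub, map_neg, map_smul, map_smul, hφv,
          hφAv]
        module
    exact fun x => LinearMap.congr_fun hlin x
  have hφd : ∀ i, φ ((c i : ℝ) • (A *ᵥ v) + (d i : ℝ) • v) =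
      -((c i : ℝ) • (B *ᵥ w)) + (d i : ℝ) • w := fun i => by
    rw [map_add, map_smul, map_smul, hφv, hφAv, smul_neg]
  have hDD' : φ '' D = D' := by
    subst hD hD'
    ext x
    constructor
    · rintro ⟨_, ⟨i, hi, rfl⟩, rfl⟩
      exact ⟨i, hi, hφd i⟩
    · rintro ⟨i, hi, rfl⟩
      exact ⟨_, ⟨i, hi, rfl⟩, hφd i⟩
  have hDfin : D.Finite := by
    refine ((Set.finite_lt_nat q.natAbs).image
      fun i => (c i : ℝ) • (A *ᵥ v) + (d i : ℝ) • v).subset ?_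
    rw [hD]
    rintro x ⟨i, hi, rfl⟩
    exact ⟨i, hi, rfl⟩
  have hDne : D.Nonempty := by
    rw [hD]
    exact ⟨_, 0, Int.natAbs_pos.2 hq, rfl⟩
  rw [← hexpA.isConnected_selfAffine_neg_iff hDfin hDne, ← hDD',
    ← image_selfAffine φ hexpA.isUnit.neg hexpB.isUnit hcomm]
  exact (φ.toHomeomorph.isConnected_image).symm
end

section
/- Let A be a 2×2 integer expanding matrix with characteristic polynomial x² + px + q where |q| = 3, and v such that {v, Av} is linearly independent. Then T(A, 𝒟) is connected for 𝒟 = {0, v, Av + v} and for 𝒟 = {0, v, −Av + v}. -/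
open Matrix Polynomial

section

attribute [local instance] Matrix.linftyOpNormedRing Matrix.linftyOpNormedAlgebra

/-- The powers of the inverse of an expanding matrix have summable norms. -/
theorem summable_norm_inv_pow {A : Matrix (Fin 2) (Fin 2) ℝ} (hdet : IsUnit A.det)
    (hexp : IsExpandingMat A) : Summable fun n => ‖A⁻¹ ^ n‖ := by
  set B : Matrix (Fin 2) (Fin 2) ℂ := A⁻¹.map (algebraMap ℝ ℂ) with hB
  have hAB : A.map (algebraMap ℝ ℂ) * B = 1 := by
    rw [hB, ← Matrix.map_mul, Matrix.mul_nonsing_inv A hdet]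
    simp
  have hBA : B * A.map (algebraMap ℝ ℂ) = 1 := by
    rw [hB, ← Matrix.map_mul, Matrix.nonsing_inv_mul A hdet]
    simp
  let U : (Matrix (Fin 2) (Fin 2) ℂ)ˣ := ⟨A.map (algebraMap ℝ ℂ), B, hAB, hBA⟩
  have hrad : spectralRadius ℂ B < 1 := by
    obtain ⟨z, hz, hzr⟩ := spectrum.exists_nnnorm_eq_spectralRadius B
    have hz0 : z ≠ 0 := by
      rintro rfl
      exact spectrum.zero_mem_iff ℂ |>.1 hz (U⁻¹).isUnit
    have hinv : z⁻¹ ∈ spectrum ℂ (A.map (algebraMap ℝ ℂ)) := by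
      have := (spectrum.inv_mem_iff (r := Units.mk0 z⁻¹ (inv_ne_zero hz0)) (a := U)).2
        (by simpa [U] using hz)
      simpa [U] using this
    have h1 := hexp _ hinv
    rw [norm_inv] at h1
    have hpos : 0 < ‖z‖ := norm_pos_iff.2 hz0
    have h2 : ‖z‖ < 1 := by
      by_contra! h
      exact absurd h1 (not_lt.2 (inv_le_one_of_one_le₀ h))
    rw [← hzr]
    exact_mod_cast h2
  obtain ⟨r, hr, hr1⟩ := ENNReal.lt_iff_exists_nnreal_btwn.1 hrad
  have hev := (spectrum.pow_nnnorm_pow_one_div_tendsto_nhds_spectralRadius B).eventually_lt_const hr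
  have hnorm : ∀ n, ‖A⁻¹ ^ n‖₊ = ‖B ^ n‖₊ := by
    intro n
    have : B ^ n = (A⁻¹ ^ n).map (algebraMap ℝ ℂ) := by
      rw [hB]; exact ((algebraMap ℝ ℂ).mapMatrix.map_pow A⁻¹ n).symm
    rw [this]
    simp [Matrix.linfty_opNNNorm_def]
  have hr1' : (r : ℝ) < 1 := by exact_mod_cast hr1
  refine Summable.of_norm_bounded_eventually_nat (g := fun n => (r : ℝ) ^ n)
    (summable_geometric_of_lt_one r.2 hr1') ?_
  filter_upwards [hev, Filter.eventually_gt_atTop 0] with n hn hn0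
  rw [norm_norm]
  have h3 : (‖B ^ n‖₊ : ENNReal) ≤ (r : ENNReal) ^ n := by
    have := ENNReal.rpow_le_rpow hn.le (Nat.cast_nonneg (α := ℝ) n)
    rwa [← ENNReal.rpow_mul, one_div_mul_cancel (by positivity), ENNReal.rpow_one,
      ENNReal.rpow_natCast] at this
  have h4 : ‖B ^ n‖₊ ≤ r ^ n := by exact_mod_cast h3
  rw [← hnorm] at h4
  exact_mod_cast h4

/-- The point `∑_{n ≥ 0} B^{n+1} D (d n)` coded by the digit sequence `d`. -/
noncomputable def codePoint {κ : Type*} (B : Matrix (Fin 2) (Fin 2) ℝ) (D : κ → Fin 2 → ℝ)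
    (d : ℕ → κ) : Fin 2 → ℝ :=
  ∑' n, (B ^ (n + 1)) *ᵥ D (d n)

variable {κ : Type*} {B : Matrix (Fin 2) (Fin 2) ℝ} {D : κ → Fin 2 → ℝ}

theorem norm_pow_mulVec_digit_le [Fintype κ] (d : ℕ → κ) (n : ℕ) :
    ‖(B ^ (n + 1)) *ᵥ D (d n)‖ ≤ ‖B ^ (n + 1)‖ * ∑ k, ‖D k‖ := by
  refine (Matrix.linfty_opNorm_mulVec _ _).trans ?_
  gcongr
  exact Finset.single_le_sum (f := fun k => ‖D k‖) (fun _ _ => norm_nonneg _) (Finset.mem_univ _)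

theorem summable_digit_bound [Fintype κ] (hB : Summable fun n => ‖B ^ n‖) (D : κ → Fin 2 → ℝ) :
    Summable fun n => ‖B ^ (n + 1)‖ * ∑ k, ‖D k‖ :=
  ((summable_nat_add_iff 1).2 hB).mul_right _

theorem summable_digits [Fintype κ] (hB : Summable fun n => ‖B ^ n‖) (d : ℕ → κ) :
    Summable fun n => (B ^ (n + 1)) *ᵥ D (d n) :=
  .of_norm_bounded (summable_digit_bound hB D) (norm_pow_mulVec_digit_le d)

theorem norm_codePoint_le [Fintype κ] (hB : Summable fun n => ‖B ^ n‖) (d : ℕ → κ) :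
    ‖codePoint B D d‖ ≤ ∑' n, ‖B ^ (n + 1)‖ * ∑ k, ‖D k‖ :=
  tsum_of_norm_bounded (summable_digit_bound hB D).hasSum (norm_pow_mulVec_digit_le d)

theorem continuous_codePoint [Fintype κ] [TopologicalSpace κ] [DiscreteTopology κ]
    (hB : Summable fun n => ‖B ^ n‖) : Continuous (codePoint B D) := by
  refine continuous_tsum (fun n => ?_) (summable_digit_bound hB D)
    (fun n d => norm_pow_mulVec_digit_le d n)
  exact (continuous_of_discreteTopology (f := fun k => (B ^ (n + 1)) *ᵥ D k)).comp
    (continuous_apply n)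

theorem codePoint_eq [Fintype κ] (hB : Summable fun n => ‖B ^ n‖) (d : ℕ → κ) :
    codePoint B D d = B *ᵥ (D (d 0) + codePoint B D fun n => d (n + 1)) := by
  have h : HasSum (fun n => (B ^ (n + 1 + 1)) *ᵥ D (d (n + 1)))
      (B *ᵥ codePoint B D fun n => d (n + 1)) := by
    have := (summable_digits (D := D) hB fun n => d (n + 1)).hasSum.map
      (Matrix.mulVecLin B) (LinearMap.continuous_of_finiteDimensional _)
    simpa only [codePoint, Function.comp_def, Matrix.mulVecLin_apply, Matrix.mulVec_mulVec,
      ← pow_succ'] using this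
  rw [codePoint, (summable_digits hB d).tsum_eq_zero_add, h.tsum_eq, Matrix.mulVec_add]
  simp

theorem selfAffine_range_eq [Fintype κ] {A : Matrix (Fin 2) (Fin 2) ℝ}
    (hA : Summable fun n => ‖A⁻¹ ^ n‖) (D : κ → Fin 2 → ℝ) :
    selfAffine A (Set.range D) = Set.range (codePoint A⁻¹ D) := by
  ext x
  constructor
  · rintro ⟨d, hd, hx⟩
    choose e he using hd
    refine ⟨e, ?_⟩
    simp only [codePoint, he]
    exact hx.tsum_eq
  · rintro ⟨e, rfl⟩
    exact ⟨fun n => D (e n), fun n => ⟨_, rfl⟩, (summable_digits hA e).hasSum⟩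

theorem eq_pow_mulVec_of_step {y : ℕ → Fin 2 → ℝ} {n : ℕ}
    (hy : ∀ m < n, y m = B *ᵥ y (m + 1)) : y 0 = (B ^ n) *ᵥ y n := by
  induction n with
  | zero => simp
  | succ n ih =>
    rw [ih fun m hm => hy m (by omega), hy n (by omega), Matrix.mulVec_mulVec, pow_succ]

theorem tendsto_norm_pow_mul (hB : Summable fun n => ‖B ^ n‖) (C : ℝ) :
    Filter.Tendsto (fun n => ‖B ^ n‖ * C) Filter.atTop (nhds 0) := by
  simpa using hB.tendsto_atTop_zero.mul_const C

/-- Points with codes agreeing on a long prefix are uniformly close. -/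
theorem exists_dist_codePoint_lt [Fintype κ] (hB : Summable fun n => ‖B ^ n‖) {δ : ℝ}
    (hδ : 0 < δ) :
    ∃ n, ∀ d d' : ℕ → κ, (∀ i < n, d i = d' i) → dist (codePoint B D d) (codePoint B D d') < δ := by
  set M := ∑' n, ‖B ^ (n + 1)‖ * ∑ k, ‖D k‖
  obtain ⟨n, hn⟩ := ((tendsto_norm_pow_mul hB (M + M)).eventually_lt_const hδ).exists
  refine ⟨n, fun d d' h => ?_⟩
  have key := eq_pow_mulVec_of_step (B := B) (n := n)
    (y := fun m => codePoint B D (fun i => d (i + m)) - codePoint B D fun i => d' (i + m)) (by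
      intro m hm
      rw [codePoint_eq hB, codePoint_eq hB fun i => d' (i + m), ← Matrix.mulVec_sub]
      simp only [zero_add, h m hm, add_sub_add_left_eq_sub]
      simp only [add_assoc, add_comm 1 m])
  simp only [add_zero] at key
  rw [dist_eq_norm, key]
  refine lt_of_le_of_lt ((Matrix.linfty_opNorm_mulVec _ _).trans ?_) hn
  gcongr
  exact norm_sub_le_of_le (norm_codePoint_le hB _) (norm_codePoint_le hB _)

/-- A bounded set `N` which is closed under the digit expansion consists of differences of
points of the self-affine set. -/
theorem exists_codePoint_sub_eq [Fintype κ] (hB : Summable fun n => ‖B ^ n‖)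
    {N : Set (Fin 2 → ℝ)} (hN : Bornology.IsBounded N)
    (hstep : ∀ x ∈ N, ∃ i j, ∃ y ∈ N, x = B *ᵥ (D i - D j + y)) {x : Fin 2 → ℝ} (hx : x ∈ N) :
    ∃ d d', codePoint B D d - codePoint B D d' = x := by
  choose f g y hyN hy using hstep
  obtain ⟨C, hC⟩ := hN.exists_norm_le
  set M := ∑' n, ‖B ^ (n + 1)‖ * ∑ k, ‖D k‖
  let s : ℕ → N := fun n => Nat.rec ⟨x, hx⟩ (fun _ z => ⟨y z.1 z.2, hyN z.1 z.2⟩) n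
  let d : ℕ → κ := fun n => f (s n).1 (s n).2
  let d' : ℕ → κ := fun n => g (s n).1 (s n).2
  refine ⟨d, d', sub_eq_zero.1 (norm_le_zero_iff.1 ?_)⟩
  refine ge_of_tendsto' (tendsto_norm_pow_mul hB (M + M + C)) fun n => ?_
  have key := eq_pow_mulVec_of_step (B := B) (n := n)
    (y := fun m => codePoint B D (fun i => d (i + m)) - codePoint B D (fun i => d' (i + m))
      - (s m).1) (by
      intro m _
      have hs : (s m).1 = B *ᵥ (D (d m) - D (d' m) + (s (m + 1)).1) := hy (s m).1 (s m).2
      conv_lhs => rw [hs]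
      rw [codePoint_eq hB, codePoint_eq hB fun i => d' (i + m), ← Matrix.mulVec_sub,
        ← Matrix.mulVec_sub]
      congr 1
      simp only [zero_add, add_assoc, add_comm 1 m]
      abel)
  simp only [add_zero] at key
  change ‖codePoint B D d - codePoint B D d' - (s 0).1‖ ≤ _
  rw [key]
  refine (Matrix.linfty_opNorm_mulVec _ _).trans ?_
  gcongr
  refine norm_sub_le_of_le ?_ (hC _ (s n).2)
  exact norm_sub_le_of_le (norm_codePoint_le hB _) (norm_codePoint_le hB _)

/-- Two digits are adjacent when the corresponding first-level pieces of the attractor meet. -/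
def DigitAdj (B : Matrix (Fin 2) (Fin 2) ℝ) (D : κ → Fin 2 → ℝ) (i j : κ) : Prop :=
  ∃ d d', D i + codePoint B D d = D j + codePoint B D d'

theorem codePoint_mem_iff_of_depends [Fintype κ] (hB : Summable fun n => ‖B ^ n‖)
    (hadj : ∀ i j, Relation.EqvGen (DigitAdj B D) i j) (n : ℕ) :
    ∀ U : Set (Fin 2 → ℝ), (∀ d d' : ℕ → κ, (∀ i < n, d i = d' i) →
      (codePoint B D d ∈ U ↔ codePoint B D d' ∈ U)) →
    ∀ d d', codePoint B D d ∈ U ↔ codePoint B D d' ∈ U := by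
  induction n with
  | zero => exact fun U h d d' => h d d' (by simp)
  | succ n ih =>
    intro U h
    have hpiece : ∀ k d d', B *ᵥ (D k + codePoint B D d) ∈ U ↔
        B *ᵥ (D k + codePoint B D d') ∈ U := by
      intro k
      refine ih {z | B *ᵥ (D k + z) ∈ U} fun d d' hd => ?_
      let shift : (ℕ → κ) → ℕ → κ := fun c i => i.casesOn k c
      have := h (shift d) (shift d') (by
        rintro (_ | i) hi
        · rfl
        · exact hd i (by omega))
      rwa [codePoint_eq hB (shift d), codePoint_eq hB (shift d')] at this
    have hall : ∀ k l, ∀ d d', B *ᵥ (D k + codePoint B D d) ∈ U ↔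
        B *ᵥ (D l + codePoint B D d') ∈ U := by
      intro k l
      induction hadj k l with
      | rel k l hkl =>
        obtain ⟨e, e', he⟩ := hkl
        intro d d'
        rw [hpiece k d e, he, hpiece l e' d']
      | refl k => exact hpiece k
      | symm k l _ ih => exact fun d d' => (ih d' d).symm
      | trans k l m _ _ ih₁ ih₂ => exact fun d d' => (ih₁ d d).trans (ih₂ d d')
    intro d d'
    rw [codePoint_eq hB d, codePoint_eq hB d']
    exact hall _ _ _ _

/-- Hata's criterion: if the adjacency graph of the digits is connected, so is the attractor. -/
theorem isConnected_range_codePoint [Fintype κ] [Nonempty κ] (hB : Summable fun n => ‖B ^ n‖)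
    (hadj : ∀ i j, Relation.EqvGen (DigitAdj B D) i j) :
    IsConnected (Set.range (codePoint B D)) := by
  refine ⟨Set.range_nonempty _, isPreconnected_iff_subset_of_disjoint.2 fun u v hu hv huv hd => ?_⟩
  let _ : TopologicalSpace κ := ⊥
  have : DiscreteTopology κ := ⟨rfl⟩
  have hcomp : IsCompact (Set.range (codePoint B D)) :=
    isCompact_range (continuous_codePoint hB)
  obtain ⟨δ, hδ, hball⟩ := lebesgue_number_lemma_of_metric_sUnion (c := {u, v}) hcomp
    (by rintro t (rfl | rfl) <;> assumption) (by simpa using huv)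
  obtain ⟨n, hn⟩ := exists_dist_codePoint_lt (D := D) hB hδ
  have hdisj : ∀ d, codePoint B D d ∈ u → codePoint B D d ∉ v := fun d h₁ h₂ =>
    (Set.ext_iff.1 hd _).1 ⟨⟨d, rfl⟩, h₁, h₂⟩
  have hconst := codePoint_mem_iff_of_depends hB hadj n u fun d d' h => by
    obtain ⟨t, ht, hsub⟩ := hball (codePoint B D d) ⟨d, rfl⟩
    have h₁ := hsub (Metric.mem_ball_self hδ)
    have h₂ := hsub (Metric.mem_ball'.2 (hn d d' h))
    rcases ht with rfl | rfl
    · exact ⟨fun _ => h₂, fun _ => h₁⟩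
    · exact ⟨fun h => absurd h₁ (hdisj _ h), fun h => absurd h₂ (hdisj _ h)⟩
  obtain ⟨k⟩ := ‹Nonempty κ›
  by_cases hk : codePoint B D (fun _ => k) ∈ u
  · left
    rintro _ ⟨d, rfl⟩
    exact (hconst _ _).1 hk
  · right
    rintro _ ⟨d, rfl⟩
    exact (huv ⟨d, rfl⟩).resolve_left fun h => hk ((hconst _ _).1 h)

end

theorem isUnit_det_of_charpoly {A : Matrix (Fin 2) (Fin 2) ℝ} {p q : ℤ} (hq : |q| = 3)
    (hchar : A.charpoly = X ^ 2 + C (p : ℝ) * X + C (q : ℝ)) : IsUnit A.det := by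
  rw [Matrix.det_eq_sign_charpoly_coeff, hchar]
  have : q ≠ 0 := by rintro rfl; simp at hq
  simpa using this

/-- The trace coefficient of an expanding quadratic with `|q| = 3` is small. -/
theorem charpoly_coeff_cases {A : Matrix (Fin 2) (Fin 2) ℝ} (hexp : IsExpandingMat A)
    {p q : ℤ} (hq : |q| = 3)
    (hchar : A.charpoly = X ^ 2 + C (p : ℝ) * X + C (q : ℝ)) :
    (q = 3 ∧ p ∈ Finset.Icc (-3) 3) ∨ (q = -3 ∧ p ∈ Finset.Icc (-1) 1) := by
  have hroot : ∀ x : ℝ, x ^ 2 + p * x + q = 0 → 1 < |x| := by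
    intro x hx
    have h := hexp (x : ℂ) (by
      rw [Matrix.mem_spectrum_iff_isRoot_charpoly, Matrix.charpoly_map, hchar]
      simp only [Polynomial.map_add, Polynomial.map_pow, Polynomial.map_mul, map_X, map_C,
        IsRoot.def, eval_add, eval_mul, eval_pow, eval_X, eval_C, Complex.coe_algebraMap]
      exact_mod_cast congrArg (fun y : ℝ => (y : ℂ)) hx)
    simpa using h
  have hcont : Continuous fun x : ℝ => x ^ 2 + p * x + q := by fun_prop
  have hsmall : ∀ x, x ∈ Set.Icc (-1 : ℝ) 1 → x ^ 2 + p * x + q ≠ 0 := fun x hx h =>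
    (abs_le.2 hx).not_gt (hroot x h)
  have huIcc : ∀ a b : ℝ, a ∈ Set.Icc (-1 : ℝ) 1 → b ∈ Set.Icc (-1 : ℝ) 1 →
      a ^ 2 + p * a + q ≤ 0 → ¬ 0 ≤ b ^ 2 + p * b + q := by
    intro a b ha hb hfa hfb
    obtain ⟨x, hx, hx0⟩ := isPreconnected_Icc.intermediate_value ha hb hcont.continuousOn
      ⟨hfa, hfb⟩
    exact hsmall x hx hx0
  rcases (abs_eq (by norm_num : (0 : ℤ) ≤ 3)).1 hq with rfl | rfl
  · refine Or.inl ⟨rfl, Finset.mem_Icc.2 ⟨?_, ?_⟩⟩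
    · by_contra! h
      have h' : (p : ℝ) ≤ -4 := by exact_mod_cast Int.le_sub_one_of_lt h
      exact huIcc 1 0 (by norm_num) (by norm_num) (by push_cast; linarith) (by norm_num)
    · by_contra! h
      have h' : (4 : ℝ) ≤ p := by exact_mod_cast h
      exact huIcc (-1) 0 (by norm_num) (by norm_num) (by push_cast; linarith) (by norm_num)
  · refine Or.inr ⟨rfl, Finset.mem_Icc.2 ⟨?_, ?_⟩⟩
    · by_contra! h
      have h' : (p : ℝ) ≤ -2 := by exact_mod_cast Int.le_sub_one_of_lt h
      exact huIcc 0 (-1) (by norm_num) (by norm_num) (by norm_num) (by push_cast; linarith)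
    · by_contra! h
      have h' : (2 : ℝ) ≤ p := by exact_mod_cast h
      exact huIcc 0 1 (by norm_num) (by norm_num) (by norm_num) (by push_cast; linarith)

/-- Coordinates of the digits `0, v, ε A v + v` in the basis `v, A v`. -/
def digitCoord (ε : ℤ) : Fin 3 → ℤ × ℤ := ![(0, 0), (1, 0), (1, ε)]

/-- `N` is a set of coordinate vectors, closed under the digit expansion, which contains enough
digit differences to connect all the digits. -/
def IsExpansionSet (p q ε : ℤ) (N : List (ℤ × ℤ)) : Prop :=
  (1, 0) ∈ N ∧ ((0, ε) ∈ N ∨ (1, ε) ∈ N) ∧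
    ∀ x ∈ N, ∃ i j, (-q * x.2, x.1 - p * x.2) - (digitCoord ε i - digitCoord ε j) ∈ N

instance (p q ε : ℤ) (N : List (ℤ × ℤ)) : Decidable (IsExpansionSet p q ε N) := by
  unfold IsExpansionSet; infer_instance

/-- The set of all `± (a, ε b)` with `(a, b) ∈ L`. -/
def signClosure (ε : ℤ) (L : List (ℤ × ℤ)) : List (ℤ × ℤ) :=
  L.flatMap fun x => [(x.1, ε * x.2), (-x.1, -(ε * x.2))]

theorem range_digitCoord {E : Type*} [AddCommGroup E] [Module ℝ E] (ε : ℤ) (v w : E) :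
    (Set.range fun k => ((digitCoord ε k).1 : ℝ) • v + ((digitCoord ε k).2 : ℝ) • w) =
      {0, v, (ε : ℝ) • w + v} := by
  ext x
  simp [digitCoord, Fin.exists_fin_succ, eq_comm, add_comm]

theorem exists_isExpansionSet {p q ε : ℤ} (hε : ε = 1 ∨ ε = -1)
    (h : (q = 3 ∧ p ∈ Finset.Icc (-3) 3) ∨ (q = -3 ∧ p ∈ Finset.Icc (-1) 1)) :
    ∃ N, IsExpansionSet p q ε N := by
  suffices ∃ L ∈ ([
      [(1, 0), (0, 1), (-4, 2), (-5, 2)], [(1, 0), (0, 1), (-3, 1), (-2, 0)],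
      [(1, 0), (0, 1), (-2, 1), (-2, 0)], [(1, 0), (0, 1), (-2, 0)],
      [(1, 0), (0, 1), (-2, -1), (2, 0)], [(1, 0), (1, 1), (-2, -1)],
      [(1, 0), (1, 1), (3, 1)]] : List (List (ℤ × ℤ))),
      IsExpansionSet p q ε (signClosure ε L) from
    this.elim fun L hL => ⟨_, hL.2⟩
  rcases hε with rfl | rfl <;> rcases h with ⟨rfl, hp⟩ | ⟨rfl, hp⟩ <;> revert p <;> decide

/-- Connectedness of the attractor with digits `0, v, ε A v + v`. -/
theorem isConnected_selfAffine_digitCoord {A : Matrix (Fin 2) (Fin 2) ℝ}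
    (hexp : IsExpandingMat A) {p q ε : ℤ} (hq : |q| = 3)
    (hchar : A.charpoly = X ^ 2 + C (p : ℝ) * X + C (q : ℝ)) (v : Fin 2 → ℝ)
    (hε : ε = 1 ∨ ε = -1) :
    IsConnected (selfAffine A (Set.range fun k =>
      ((digitCoord ε k).1 : ℝ) • v + ((digitCoord ε k).2 : ℝ) • (A *ᵥ v))) := by
  have hdet := isUnit_det_of_charpoly hq hchar
  have hB := summable_norm_inv_pow hdet hexp
  obtain ⟨N, h₀, h₁, hstep⟩ := exists_isExpansionSet hε (charpoly_coeff_cases hexp hq hchar)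
  let φ : ℤ × ℤ → Fin 2 → ℝ := fun x => (x.1 : ℝ) • v + (x.2 : ℝ) • (A *ᵥ v)
  have hφadd : ∀ x y, φ (x + y) = φ x + φ y := fun x y => by
    simp only [φ, Prod.fst_add, Prod.snd_add]; push_cast; module
  have hφsub : ∀ x y, φ (x - y) = φ x - φ y := fun x y => by
    simp only [φ, Prod.fst_sub, Prod.snd_sub]; push_cast; module
  have hA2 : A *ᵥ (A *ᵥ v) = (-p : ℝ) • (A *ᵥ v) + (-q : ℝ) • v := by
    have h := A.aeval_self_charpoly
    rw [hchar] at h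
    have h' := congrArg (fun M => M *ᵥ v) h
    simp only [map_add, map_mul, aeval_X, aeval_C, Matrix.add_mulVec, pow_two,
      Algebra.algebraMap_eq_smul_one, Matrix.smul_mul, one_mul, Matrix.smul_mulVec,
      Matrix.one_mulVec, Matrix.zero_mulVec, ← Matrix.mulVec_mulVec] at h'
    linear_combination (norm := module) h'
  have hφA : ∀ x : ℤ × ℤ, A *ᵥ φ x = φ (-q * x.2, x.1 - p * x.2) := fun x => by
    simp only [φ, Matrix.mulVec_add, Matrix.mulVec_smul, hA2]; push_cast; module
  rw [selfAffine_range_eq hB]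
  change IsConnected (Set.range (codePoint A⁻¹ fun k => φ (digitCoord ε k)))
  have hdiff : ∀ x ∈ N, ∃ d d', codePoint A⁻¹ (fun k => φ (digitCoord ε k)) d -
      codePoint A⁻¹ (fun k => φ (digitCoord ε k)) d' = φ x := by
    intro x hx
    refine exists_codePoint_sub_eq (N := φ '' {x | x ∈ N}) hB
      (N.finite_toSet.image φ).isBounded ?_ ⟨x, hx, rfl⟩
    rintro _ ⟨x, hx, rfl⟩
    obtain ⟨i, j, hij⟩ := hstep x hx
    refine ⟨i, j, _, ⟨_, hij, rfl⟩, ?_⟩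
    rw [← hφsub, ← hφadd, add_sub_cancel, ← hφA, Matrix.mulVec_mulVec,
      Matrix.nonsing_inv_mul A hdet, Matrix.one_mulVec]
  have hadj : ∀ i j, digitCoord ε j - digitCoord ε i ∈ N →
      Relation.EqvGen (DigitAdj A⁻¹ fun k => φ (digitCoord ε k)) i j := by
    intro i j hij
    obtain ⟨d, d', h⟩ := hdiff _ hij
    refine .rel _ _ ⟨d, d', ?_⟩
    rw [hφsub] at h
    linear_combination (norm := module) h
  have h01 := hadj 0 1 (by simpa [digitCoord] using h₀)
  have h02 : Relation.EqvGen (DigitAdj A⁻¹ fun k => φ (digitCoord ε k)) 0 2 := by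
    rcases h₁ with h₁ | h₁
    · exact h01.trans _ _ _ (hadj 1 2 (by simpa [digitCoord] using h₁))
    · exact hadj 0 2 (by simpa [digitCoord] using h₁)
  have h0 : ∀ i, Relation.EqvGen (DigitAdj A⁻¹ fun k => φ (digitCoord ε k)) 0 i := by
    intro i
    fin_cases i
    exacts [.refl _, h01, h02]
  exact isConnected_range_codePoint hB fun i j => ((h0 i).symm _ _).trans _ _ _ (h0 j)

theorem stmt17 (A : Matrix (Fin 2) (Fin 2) ℝ)
    (hint : IsIntMat A) (hexp : IsExpandingMat A)
    (p q : ℤ) (hq : |q| = 3)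
    (hchar : A.charpoly = X ^ 2 + C (p : ℝ) * X + C (q : ℝ))
    (v : Fin 2 → ℝ) (hv : LinearIndependent ℝ ![v, A *ᵥ v]) :
    IsConnected (selfAffine A {0, v, A *ᵥ v + v}) ∧
    IsConnected (selfAffine A {0, v, -(A *ᵥ v) + v}) := by
  have h₁ := isConnected_selfAffine_digitCoord hexp hq hchar v (ε := 1) (.inl rfl)
  have h₂ := isConnected_selfAffine_digitCoord hexp hq hchar v (ε := -1) (.inr rfl)
  rw [range_digitCoord] at h₁ h₂
  exact ⟨by simpa only [Int.cast_one, one_smul] using h₁,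
    by simpa only [Int.cast_neg, Int.cast_one, neg_smul, one_smul] using h₂⟩
end
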